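/- Let m > 1, ω > 0 and α, β ∈ ℝ. Then the functions A and B are continuously differentiable on (0,∞) (in particular, the one-sided values and one-sided derivatives of the two branches agree at φ = 1), A is strictly increasing on (0,∞), and the range of A equals (0,1) if α = 0 and equals (0,∞) if α ≠ 0. -/

import Mathlib

/-- The function `A` of the general model:
`A(φ) = (α² + 1/m)φ` for `φ ≤ 1`, `A(φ) = 1 - ((m-1)/m)φ^{-1/(m-1)} + α²φ` for `φ > 1`. -/
noncomputable def Agen (m α φ : ℝ) : ℝ :=
  if φ ≤ 1 then (α ^ 2 + 1 / m) * φ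
  else 1 - (m - 1) / m * φ ^ (-(1 / (m - 1))) + α ^ 2 * φ

/-- The function `B` of the general model:
`B(φ) = (β+ω)φ - ω(α²+1/m)φ² - ω(m-1)/m` for `φ ≤ 1`,
`B(φ) = βφ - ωα²φ² + ((m-1)/m)ω(φ^{(m-2)/(m-1)} - 1)` for `φ > 1`. -/
noncomputable def Bgen (m ω α β φ : ℝ) : ℝ :=
  if φ ≤ 1 then (β + ω) * φ - ω * (α ^ 2 + 1 / m) * φ ^ 2 - ω * (m - 1) / m
  else β * φ - ω * α ^ 2 * φ ^ 2 + (m - 1) / m * ω * (φ ^ ((m - 2) / (m - 1)) - 1)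

open Set Filter Topology

theorem hasDerivAt_ite_le {f g f' g' : ℝ → ℝ} {a x : ℝ} (hf : HasDerivAt f (f' x) x)
    (hg : HasDerivAt g (g' x) x) (h : f a = g a) (h' : f' a = g' a) :
    HasDerivAt (fun y => if y ≤ a then f y else g y) (if x ≤ a then f' x else g' x) x := by
  rcases lt_trichotomy x a with hx | rfl | hx
  · rw [if_pos hx.le]
    refine hf.congr_of_eventuallyEq ?_
    filter_upwards [Iio_mem_nhds hx] with y hy
    exact if_pos (le_of_lt hy)
  · rw [if_pos le_rfl, ← hasDerivWithinAt_univ, ← Iic_union_Ici (a := x)]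
    refine HasDerivWithinAt.union
      (hf.hasDerivWithinAt.congr (fun y hy => if_pos (mem_Iic.1 hy)) (if_pos le_rfl)) ?_
    rw [h']
    refine hg.hasDerivWithinAt.congr (fun y hy => ?_) (by simp [h])
    rcases (mem_Ici.1 hy).eq_or_lt with rfl | hy
    · simp [h]
    · exact if_neg hy.not_ge
  · rw [if_neg hx.not_ge]
    refine hg.congr_of_eventuallyEq ?_
    filter_upwards [Ioi_mem_nhds hx] with y hy
    exact if_neg (not_le_of_gt hy)

theorem contDiffOn_one_of_hasDerivAt {f f' : ℝ → ℝ} {s : Set ℝ} (hs : IsOpen s)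
    (hf : ∀ x ∈ s, HasDerivAt f (f' x) x) (hf' : ContinuousOn f' s) : ContDiffOn ℝ 1 f s := by
  rw [show (1 : WithTop ℕ∞) = 0 + 1 by simp, contDiffOn_succ_iff_deriv_of_isOpen hs]
  refine ⟨fun x hx => (hf x hx).differentiableAt.differentiableWithinAt, by simp, ?_⟩
  exact contDiffOn_zero.2 (hf'.congr fun x hx => (hf x hx).deriv)

theorem continuousOn_ite_le {f g : ℝ → ℝ} {a : ℝ} {s : Set ℝ} (hf : ContinuousOn f s)
    (hg : ContinuousOn g s) (h : f a = g a) :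
    ContinuousOn (fun y => if y ≤ a then f y else g y) s := by
  refine ContinuousOn.if (fun x hx => ?_) (hf.mono inter_subset_left) (hg.mono inter_subset_left)
  have : x = a := by
    have := hx.2
    rw [show {y : ℝ | y ≤ a} = Iic a from rfl, frontier_Iic] at this
    exact this
  rw [this, h]

theorem hasDerivAt_Agen_right {m α x : ℝ} (hm : 1 < m) (hx : 0 < x) :
    HasDerivAt (fun φ : ℝ => 1 - (m - 1) / m * φ ^ (-(1 / (m - 1))) + α ^ 2 * φ)
      (1 / m * x ^ (-(1 / (m - 1)) - 1) + α ^ 2) x := by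
  have hm1 : m - 1 ≠ 0 := by linarith
  have := (((Real.hasDerivAt_rpow_const (p := -(1 / (m - 1))) (Or.inl hx.ne')).const_mul
    ((m - 1) / m)).const_sub 1).add ((hasDerivAt_id x).const_mul (α ^ 2))
  refine this.congr_deriv ?_
  field_simp

theorem hasDerivAt_Agen_left (m α x : ℝ) :
    HasDerivAt (fun φ : ℝ => (α ^ 2 + 1 / m) * φ) (α ^ 2 + 1 / m) x := by
  simpa using (hasDerivAt_id x).const_mul (α ^ 2 + 1 / m)

theorem hasDerivAt_Bgen_left (m ω α β x : ℝ) :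
    HasDerivAt (fun φ : ℝ => (β + ω) * φ - ω * (α ^ 2 + 1 / m) * φ ^ 2 - ω * (m - 1) / m)
      (β + ω - 2 * (ω * (α ^ 2 + 1 / m)) * x) x := by
  have := (((hasDerivAt_id x).const_mul (β + ω)).sub
    ((hasDerivAt_pow 2 x).const_mul (ω * (α ^ 2 + 1 / m)))).sub_const (ω * (m - 1) / m)
  refine this.congr_deriv ?_
  simp
  ring

theorem hasDerivAt_Bgen_right {m ω α β x : ℝ} (hm : 1 < m) (hx : 0 < x) :
    HasDerivAt (fun φ : ℝ => β * φ - ω * α ^ 2 * φ ^ 2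
        + (m - 1) / m * ω * (φ ^ ((m - 2) / (m - 1)) - 1))
      (β - 2 * (ω * α ^ 2) * x + (m - 2) / m * ω * x ^ ((m - 2) / (m - 1) - 1)) x := by
  have hm1 : m - 1 ≠ 0 := by linarith
  have := (((hasDerivAt_id x).const_mul β).sub
    ((hasDerivAt_pow 2 x).const_mul (ω * α ^ 2))).add
    (((Real.hasDerivAt_rpow_const (p := (m - 2) / (m - 1)) (Or.inl hx.ne')).sub_const
      1).const_mul ((m - 1) / m * ω))
  refine this.congr_deriv ?_
  field_simp
  simp
  ring

theorem continuousOn_rpow_const_Ioi (p : ℝ) : ContinuousOn (fun x : ℝ => x ^ p) (Ioi 0) :=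
  fun x hx => (Real.continuousAt_rpow_const x p (Or.inl (ne_of_gt hx))).continuousWithinAt

theorem Agen_branches_eq {m : ℝ} (α : ℝ) (hm : 1 < m) :
    (α ^ 2 + 1 / m) * 1 = 1 - (m - 1) / m * (1 : ℝ) ^ (-(1 / (m - 1))) + α ^ 2 * 1 := by
  rw [Real.one_rpow]
  field_simp
  ring

theorem Bgen_branches_eq {m : ℝ} (ω α β : ℝ) (hm : 1 < m) :
    (β + ω) * 1 - ω * (α ^ 2 + 1 / m) * 1 ^ 2 - ω * (m - 1) / m
      = β * 1 - ω * α ^ 2 * 1 ^ 2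
          + (m - 1) / m * ω * ((1 : ℝ) ^ ((m - 2) / (m - 1)) - 1) := by
  rw [Real.one_rpow]
  field_simp
  ring

theorem Bgen_deriv_branches_eq {m : ℝ} (ω α β : ℝ) (hm : 1 < m) :
    β + ω - 2 * (ω * (α ^ 2 + 1 / m)) * 1
      = β - 2 * (ω * α ^ 2) * 1 + (m - 2) / m * ω * (1 : ℝ) ^ ((m - 2) / (m - 1) - 1) := by
  rw [Real.one_rpow]
  field_simp
  ring

theorem hasDerivAt_Agen {m x : ℝ} (α : ℝ) (hm : 1 < m) (hx : 0 < x) :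
    HasDerivAt (Agen m α)
      (if x ≤ 1 then α ^ 2 + 1 / m else 1 / m * x ^ (-(1 / (m - 1)) - 1) + α ^ 2) x :=
  hasDerivAt_ite_le (f' := fun _ => α ^ 2 + 1 / m)
    (g' := fun x => 1 / m * x ^ (-(1 / (m - 1)) - 1) + α ^ 2)
    (hasDerivAt_Agen_left m α x) (hasDerivAt_Agen_right hm hx)
    (Agen_branches_eq α hm) (by simp [add_comm])

theorem contDiffOn_Agen {m : ℝ} (α : ℝ) (hm : 1 < m) : ContDiffOn ℝ 1 (Agen m α) (Ioi 0) :=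
  contDiffOn_one_of_hasDerivAt isOpen_Ioi (fun _ hx => hasDerivAt_Agen α hm hx)
    (continuousOn_ite_le continuousOn_const
      (((continuousOn_rpow_const_Ioi _).const_mul _).add continuousOn_const)
      (by simp [add_comm]))

theorem contDiffOn_Bgen {m : ℝ} (ω α β : ℝ) (hm : 1 < m) :
    ContDiffOn ℝ 1 (Bgen m ω α β) (Ioi 0) :=
  contDiffOn_one_of_hasDerivAt isOpen_Ioi
    (fun x hx => hasDerivAt_ite_le (hasDerivAt_Bgen_left m ω α β x)
      (g' := fun x => β - 2 * (ω * α ^ 2) * x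
        + (m - 2) / m * ω * x ^ ((m - 2) / (m - 1) - 1))
      (f' := fun x => β + ω - 2 * (ω * (α ^ 2 + 1 / m)) * x)
      (hasDerivAt_Bgen_right hm hx) (Bgen_branches_eq ω α β hm)
      (Bgen_deriv_branches_eq ω α β hm))
    (continuousOn_ite_le (by fun_prop)
      ((by fun_prop : ContinuousOn (fun x : ℝ => β - 2 * (ω * α ^ 2) * x) (Ioi 0)).add
        ((continuousOn_rpow_const_Ioi _).const_mul _))
      (Bgen_deriv_branches_eq ω α β hm))

theorem strictMonoOn_Agen {m : ℝ} (α : ℝ) (hm : 1 < m) : StrictMonoOn (Agen m α) (Ioi 0) := by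
  refine strictMonoOn_of_deriv_pos (convex_Ioi 0) (contDiffOn_Agen α hm).continuousOn
    fun x hx => ?_
  rw [interior_Ioi] at hx
  have hx0 : 0 < x := hx
  rw [(hasDerivAt_Agen α hm hx0).deriv]
  have : 0 < m := by linarith
  split_ifs <;> positivity

theorem Agen_pos {m x : ℝ} (α : ℝ) (hm : 1 < m) (hx : 0 < x) : 0 < Agen m α x := by
  have hm0 : 0 < m := by linarith
  rcases le_or_gt x 1 with h | h
  · rw [Agen, if_pos h]
    positivity
  · refine lt_trans ?_ (strictMonoOn_Agen α hm (mem_Ioi.2 one_pos) hx h)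
    rw [Agen, if_pos le_rfl]
    positivity

theorem Agen_zero_lt_one {m x : ℝ} (hm : 1 < m) (hx : 0 < x) : Agen m 0 x < 1 := by
  have hm0 : 0 < m - 1 := by linarith
  have hy : 0 < max x 1 + 1 := by positivity
  refine lt_of_lt_of_le (strictMonoOn_Agen 0 hm hx hy
    ((le_max_left x 1).trans_lt (lt_add_one _))) ?_
  rw [Agen, if_neg (by linarith [le_max_right x 1])]
  have : 0 ≤ (m - 1) / m * (max x 1 + 1) ^ (-(1 / (m - 1))) := by positivity
  linarith

theorem tendsto_Agen_nhdsGT_zero (m α : ℝ) : Tendsto (Agen m α) (𝓝[>] 0) (𝓝 0) := by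
  have h : Tendsto (fun φ : ℝ => (α ^ 2 + 1 / m) * φ) (𝓝[>] 0) (𝓝 0) :=
    ((continuous_const.mul continuous_id).tendsto' 0 0 (by simp)).mono_left nhdsWithin_le_nhds
  refine h.congr' ?_
  filter_upwards [nhdsWithin_le_nhds (Iio_mem_nhds one_pos)] with x hx
  exact (if_pos (le_of_lt hx)).symm

theorem Agen_eventuallyEq_atTop (m α : ℝ) : (fun φ : ℝ =>
    1 - (m - 1) / m * φ ^ (-(1 / (m - 1))) + α ^ 2 * φ) =ᶠ[atTop] Agen m α := by
  filter_upwards [eventually_gt_atTop 1] with x hx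
  exact (if_neg hx.not_ge).symm

theorem tendsto_Agen_saturation {m : ℝ} (hm : 1 < m) :
    Tendsto (fun φ : ℝ => 1 - (m - 1) / m * φ ^ (-(1 / (m - 1)))) atTop (𝓝 1) := by
  have hm1 : 0 < 1 / (m - 1) := by
    have : 0 < m - 1 := by linarith
    positivity
  simpa using ((tendsto_rpow_neg_atTop hm1).const_mul ((m - 1) / m)).const_sub 1

theorem tendsto_Agen_zero_atTop {m : ℝ} (hm : 1 < m) : Tendsto (Agen m 0) atTop (𝓝 1) := by
  refine Tendsto.congr' (Agen_eventuallyEq_atTop m 0) ?_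
  simpa using tendsto_Agen_saturation hm

theorem tendsto_Agen_atTop {m α : ℝ} (hm : 1 < m) (hα : α ≠ 0) :
    Tendsto (Agen m α) atTop atTop := by
  refine Tendsto.congr' (Agen_eventuallyEq_atTop m α) ?_
  exact (tendsto_Agen_saturation hm).add_atTop
    (tendsto_id.const_mul_atTop (by positivity))

/-- Let `m > 1`, `ω > 0`, `α β ∈ ℝ`.  Then `A` and `B` are continuously
differentiable on `(0,∞)` (in particular the values and derivatives of the two
branches agree at `φ = 1`), `A` is strictly increasing on `(0,∞)`, and the range
of `A` on `(0,∞)` is `(0,1)` if `α = 0` and `(0,∞)` if `α ≠ 0`. -/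
theorem stmt_14 (m ω α β : ℝ) (hm : 1 < m) (hω : 0 < ω) :
    ContDiffOn ℝ 1 (Agen m α) (Set.Ioi 0) ∧
    ContDiffOn ℝ 1 (Bgen m ω α β) (Set.Ioi 0) ∧
    ((α ^ 2 + 1 / m) * 1
      = 1 - (m - 1) / m * (1 : ℝ) ^ (-(1 / (m - 1))) + α ^ 2 * 1) ∧
    deriv (fun φ : ℝ => (α ^ 2 + 1 / m) * φ) 1
      = deriv (fun φ : ℝ => 1 - (m - 1) / m * φ ^ (-(1 / (m - 1))) + α ^ 2 * φ) 1 ∧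
    ((β + ω) * 1 - ω * (α ^ 2 + 1 / m) * 1 ^ 2 - ω * (m - 1) / m
      = β * 1 - ω * α ^ 2 * 1 ^ 2
          + (m - 1) / m * ω * ((1 : ℝ) ^ ((m - 2) / (m - 1)) - 1)) ∧
    deriv (fun φ : ℝ => (β + ω) * φ - ω * (α ^ 2 + 1 / m) * φ ^ 2 - ω * (m - 1) / m) 1
      = deriv (fun φ : ℝ => β * φ - ω * α ^ 2 * φ ^ 2
          + (m - 1) / m * ω * (φ ^ ((m - 2) / (m - 1)) - 1)) 1 ∧
    StrictMonoOn (Agen m α) (Set.Ioi 0) ∧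
    (α = 0 → Agen m α '' Set.Ioi 0 = Set.Ioo 0 1) ∧
    (α ≠ 0 → Agen m α '' Set.Ioi 0 = Set.Ioi 0) := by
  have hAl := (hasDerivAt_Agen_left m α 1).deriv
  have hAr := (hasDerivAt_Agen_right (α := α) hm one_pos).deriv
  have hBl := (hasDerivAt_Bgen_left m ω α β 1).deriv
  have hBr := (hasDerivAt_Bgen_right (ω := ω) (α := α) (β := β) hm one_pos).deriv
  have hcont := (contDiffOn_Agen α hm).continuousOn
  refine ⟨contDiffOn_Agen α hm, contDiffOn_Bgen ω α β hm, Agen_branches_eq α hm, ?_,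
    Bgen_branches_eq ω α β hm, ?_, strictMonoOn_Agen α hm, ?_, fun hα => ?_⟩
  · rw [hAl, hAr, Real.one_rpow]
    ring
  · rw [hBl, hBr]
    exact Bgen_deriv_branches_eq ω α β hm
  · rintro rfl
    refine Subset.antisymm ?_ ?_
    · rintro _ ⟨x, hx, rfl⟩
      exact ⟨Agen_pos 0 hm hx, Agen_zero_lt_one hm hx⟩
    · exact isPreconnected_Ioi.intermediate_value_Ioo (l₁ := 𝓝[>] 0)
        (le_principal_iff.2 self_mem_nhdsWithin)
        (le_principal_iff.2 (Ioi_mem_atTop 0)) hcont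
        (tendsto_Agen_nhdsGT_zero m 0) (tendsto_Agen_zero_atTop hm)
  · refine Subset.antisymm ?_ ?_
    · rintro _ ⟨x, hx, rfl⟩
      exact Agen_pos α hm hx
    · exact isPreconnected_Ioi.intermediate_value_Ioi (l₁ := 𝓝[>] 0)
        (le_principal_iff.2 self_mem_nhdsWithin)
        (le_principal_iff.2 (Ioi_mem_atTop 0)) hcont
        (tendsto_Agen_nhdsGT_zero m α) (tendsto_Agen_atTop hm hα)
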